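/- Beltrami theorem: let g and ḡ be projectively equivalent Riemannian metrics on a connected manifold M of dimension n ≥ 2. If g has constant sectional curvature, then ḡ also has constant sectional curvature. -/

import Mathlib

open scoped ContDiff

noncomputable section

namespace ProjGeo

/-- The partial derivative of a function on `ℝⁿ` in the `j`-th coordinate direction. -/
def pd {n : ℕ} (j : Fin n) (f : (Fin n → ℝ) → ℝ) (p : Fin n → ℝ) : ℝ :=
  fderiv ℝ f p (Pi.single j 1)

/-- Christoffel symbols in coordinates: `Γ p i j k` represents `Γ^i_{jk}` at the point `p`. -/
abbrev Christoffel (n : ℕ) := (Fin n → ℝ) → Fin n → Fin n → Fin n → ℝ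

/-- A connection is torsion-free (symmetric) if `Γ^i_{jk} = Γ^i_{kj}`. -/
def TorsionFree {n : ℕ} (Γ : Christoffel n) : Prop :=
  ∀ p i j k, Γ p i j k = Γ p i k j

/-- Smoothness of the Christoffel symbols on the open set `U`. -/
def SmoothChristoffelOn {n : ℕ} (U : Set (Fin n → ℝ)) (Γ : Christoffel n) : Prop :=
  ∀ i j k, ContDiffOn ℝ ∞ (fun p => Γ p i j k) U

/-- `γ` is a (parameterized) geodesic of the connection `Γ` on the parameter set `I`,
staying inside `U`: it is smooth and satisfies `γ̈^i + Γ^i_{jk} γ̇^j γ̇^k = 0`. -/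
def IsGeodesicOn {n : ℕ} (U : Set (Fin n → ℝ)) (Γ : Christoffel n)
    (γ : ℝ → Fin n → ℝ) (I : Set ℝ) : Prop :=
  (∀ t ∈ I, γ t ∈ U) ∧ (∀ i, ContDiffOn ℝ ∞ (fun t => γ t i) I) ∧
  ∀ t ∈ I, ∀ i,
    deriv (fun s => deriv (fun u => γ u i) s) t
      + ∑ j, ∑ k, Γ (γ t) i j k * deriv (fun u => γ u j) t * deriv (fun u => γ u k) t = 0

/-- `h` is a smooth regular reparameterisation defined on `J` and mapping `J` bijectively
onto `I`. -/
def IsReparam (I J : Set ℝ) (h : ℝ → ℝ) : Prop :=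
  ContDiffOn ℝ ∞ h J ∧ (∀ t ∈ J, deriv h t ≠ 0) ∧ Set.BijOn h J I

/-- Two connections are projectively equivalent on `U`: each geodesic of the one is, after a
suitable reparameterisation, a geodesic of the other, and vice versa. -/
def ProjEquivOn {n : ℕ} (U : Set (Fin n → ℝ)) (Γ Γ' : Christoffel n) : Prop :=
  (∀ γ I, IsOpen I → IsGeodesicOn U Γ γ I →
    ∃ h J, IsOpen J ∧ IsReparam I J h ∧ IsGeodesicOn U Γ' (fun t => γ (h t)) J) ∧
  (∀ γ I, IsOpen I → IsGeodesicOn U Γ' γ I →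
    ∃ h J, IsOpen J ∧ IsReparam I J h ∧ IsGeodesicOn U Γ (fun t => γ (h t)) J)

/-- `Γ'` is obtained from `Γ` by the projective change associated with the 1-form `φ`:
`Γ'^i_{jk} = Γ^i_{jk} + φ_k δ^i_j + φ_j δ^i_k` on `U`. -/
def ProjChange {n : ℕ} (Γ Γ' : Christoffel n) (φ : (Fin n → ℝ) → Fin n → ℝ)
    (U : Set (Fin n → ℝ)) : Prop :=
  ∀ p ∈ U, ∀ i j k, Γ' p i j k =
    Γ p i j k + (if i = j then φ p k else 0) + (if i = k then φ p j else 0)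

end ProjGeo

namespace ProjGeo

/-- A (pseudo-Riemannian) metric on `U` in coordinates: a smooth symmetric nondegenerate
matrix-valued function. -/
def MetricOn {n : ℕ} (U : Set (Fin n → ℝ))
    (g : (Fin n → ℝ) → Matrix (Fin n) (Fin n) ℝ) : Prop :=
  (∀ i j, ContDiffOn ℝ ∞ (fun p => g p i j) U) ∧
  (∀ p ∈ U, ∀ i j, g p i j = g p j i) ∧
  (∀ p ∈ U, (g p).det ≠ 0)

/-- A Riemannian (positive definite) metric on `U` in coordinates. -/
def RiemannianOn {n : ℕ} (U : Set (Fin n → ℝ))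
    (g : (Fin n → ℝ) → Matrix (Fin n) (Fin n) ℝ) : Prop :=
  MetricOn U g ∧
  ∀ p ∈ U, ∀ v : Fin n → ℝ, v ≠ 0 → 0 < ∑ i, ∑ j, g p i j * v i * v j

/-- The Christoffel symbols of the Levi-Civita connection of the metric `g`:
`Γ^i_{jk} = ½ g^{is} (∂_j g_{sk} + ∂_k g_{sj} − ∂_s g_{jk})`. -/
def LeviCivita {n : ℕ} (g : (Fin n → ℝ) → Matrix (Fin n) (Fin n) ℝ) : Christoffel n :=
  fun p i j k => (1 / 2) * ∑ s, (g p)⁻¹ i s *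
    (pd j (fun q => g q s k) p + pd k (fun q => g q s j) p - pd s (fun q => g q j k) p)

end ProjGeo

namespace ProjGeo

/-- The curvature tensor `R^h_{ijk}` of the connection `Γ`:
`R^h_{ijk} = ∂_j Γ^h_{ik} − ∂_k Γ^h_{ij} + Γ^a_{ik} Γ^h_{aj} − Γ^a_{ij} Γ^h_{ak}`. -/
def curv {n : ℕ} (Γ : Christoffel n) (p : Fin n → ℝ) (h i j k : Fin n) : ℝ :=
  pd j (fun q => Γ q h i k) p - pd k (fun q => Γ q h i j) p
    + ∑ a, Γ p a i k * Γ p h a j - ∑ a, Γ p a i j * Γ p h a k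

/-- The Ricci tensor `R_{ij} = R^s_{isj}` of the connection `Γ`. -/
def ric {n : ℕ} (Γ : Christoffel n) (p : Fin n → ℝ) (i j : Fin n) : ℝ :=
  ∑ s, curv Γ p s i s j

end ProjGeo

namespace ProjGeo

/-- The curvature tensor with lowered index, `R_{hijk} = g_{hs} R^s_{ijk}`. -/
def lowCurv {n : ℕ} (g : (Fin n → ℝ) → Matrix (Fin n) (Fin n) ℝ)
    (p : Fin n → ℝ) (h i j k : Fin n) : ℝ :=
  ∑ s, g p h s * curv (LeviCivita g) p s i j k

/-- `g` has constant sectional curvature on `U`: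
`R_{hijk} = c (g_{hk} g_{ij} − g_{hj} g_{ik})` for a constant `c`. -/
def HasConstSectionalCurv {n : ℕ} (U : Set (Fin n → ℝ))
    (g : (Fin n → ℝ) → Matrix (Fin n) (Fin n) ℝ) : Prop :=
  ∃ c : ℝ, ∀ p ∈ U, ∀ h i j k,
    lowCurv g p h i j k = c * (g p h k * g p i j - g p h j * g p i k)

/-- Solutions of a smooth autonomous differential equation are smooth. -/
lemma contDiffOn_of_hasDerivAt {E : Type*} [NormedAddCommGroup E] [NormedSpace ℝ E]
    {F : E → E} {W : Set E} (hF : ContDiffOn ℝ ∞ F W) {α : ℝ → E} {I : Set ℝ} (hI : IsOpen I)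
    (hW : ∀ t ∈ I, α t ∈ W) (hα : ∀ t ∈ I, HasDerivAt α (F (α t)) t) :
    ContDiffOn ℝ ∞ α I := by
  have key : ∀ m : ℕ, ContDiffOn ℝ m α I := by
    intro m
    induction m with
    | zero =>
      exact contDiffOn_zero.2 fun t ht => (hα t ht).continuousAt.continuousWithinAt
    | succ m ih =>
      push_cast
      rw [contDiffOn_succ_iff_deriv_of_isOpen hI]
      refine ⟨fun t ht => (hα t ht).differentiableAt.differentiableWithinAt, by simp, ?_⟩
      refine ContDiffOn.congr (f := fun t => F (α t)) ?_ fun t ht => (hα t ht).deriv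
      exact (hF.of_le (mod_cast le_top)).comp ih hW
  exact contDiffOn_infty.2 key

/-- Local existence of geodesics with prescribed initial position and velocity. -/
lemma exists_isGeodesicOn {n : ℕ} {U : Set (Fin n → ℝ)} (hU : IsOpen U) {Γ : Christoffel n}
    (hΓ : SmoothChristoffelOn U Γ) {p : Fin n → ℝ} (hp : p ∈ U) (v : Fin n → ℝ) :
    ∃ γ I, IsOpen I ∧ (0 : ℝ) ∈ I ∧ IsGeodesicOn U Γ γ I ∧ γ 0 = p ∧
      ∀ i, deriv (fun t => γ t i) 0 = v i := by
  set F : (Fin n → ℝ) × (Fin n → ℝ) → (Fin n → ℝ) × (Fin n → ℝ) := fun x =>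
    (x.2, fun i => -∑ j, ∑ k, Γ x.1 i j k * x.2 j * x.2 k) with hFdef
  set W : Set ((Fin n → ℝ) × (Fin n → ℝ)) := Prod.fst ⁻¹' U with hWdef
  have hW : IsOpen W := hU.preimage continuous_fst
  have hF : ContDiffOn ℝ ∞ F W := by
    refine contDiffOn_snd.prodMk (contDiffOn_pi.2 fun i => ContDiffOn.neg ?_)
    refine ContDiffOn.sum fun j _ => ContDiffOn.sum fun k _ => ?_
    refine (((hΓ i j k).comp contDiffOn_fst fun x hx => hx).mul ?_).mul ?_
    · exact ((contDiff_apply ℝ ℝ j).comp contDiff_snd).contDiffOn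
    · exact ((contDiff_apply ℝ ℝ k).comp contDiff_snd).contDiffOn
  have hF1 : ContDiffAt ℝ 1 F (p, v) :=
    (hF.contDiffAt (hW.mem_nhds hp)).of_le (mod_cast le_top)
  obtain ⟨α, hα0, ε, hε, hα⟩ :=
    hF1.exists_forall_mem_closedBall_exists_eq_forall_mem_Ioo_hasDerivAt₀ 0
  have hcont : ContinuousOn α (Set.Ioo (0 - ε) (0 + ε)) := fun t ht =>
    (hα t ht).continuousAt.continuousWithinAt
  set I : Set ℝ := Set.Ioo (0 - ε) (0 + ε) ∩ α ⁻¹' W with hIdef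
  have hI : IsOpen I := hcont.isOpen_inter_preimage isOpen_Ioo hW
  have h0 : (0 : ℝ) ∈ I := ⟨by simp [hε], by simp [hα0, hWdef, hp]⟩
  have hsm : ContDiffOn ℝ ∞ α I :=
    contDiffOn_of_hasDerivAt hF hI (fun t ht => ht.2) fun t ht => hα t ht.1
  have hd1 : ∀ t ∈ I, ∀ i, HasDerivAt (fun u => (α u).1 i) ((α t).2 i) t := fun t ht i =>
    (hasDerivAt_pi.1 (hα t ht.1).fst) i
  have hd2 : ∀ t ∈ I, ∀ i, HasDerivAt (fun u => (α u).2 i) ((F (α t)).2 i) t := fun t ht i =>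
    (hasDerivAt_pi.1 (hα t ht.1).snd) i
  refine ⟨fun t => (α t).1, I, hI, h0, ⟨fun t ht => ht.2, fun i => ?_, fun t ht i => ?_⟩,
    by simp [hα0], fun i => ?_⟩
  · exact ((contDiff_apply ℝ ℝ i).comp contDiff_fst).comp_contDiffOn hsm
  · have heq : (fun s => deriv (fun u => (α u).1 i) s) =ᶠ[nhds t] fun s => (α s).2 i := by
      filter_upwards [hI.mem_nhds ht] with s hs using (hd1 s hs i).deriv
    rw [heq.deriv_eq, (hd2 t ht i).deriv]
    simp only [(hd1 t ht _).deriv]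
    simp [hFdef]
  · rw [(hd1 0 h0 i).deriv, hα0]

/-- If every geodesic of `Γ` can be reparameterised to a geodesic of `Γ'`, then the difference
`Γ' - Γ`, evaluated on a pair of equal vectors, is proportional to that vector. -/
lemma ProjEquivOn.exists_sum_sub_eq_mul {n : ℕ} {U : Set (Fin n → ℝ)} (hU : IsOpen U)
    {Γ Γ' : Christoffel n} (hΓ : SmoothChristoffelOn U Γ) (h : ProjEquivOn U Γ Γ')
    {p : Fin n → ℝ} (hp : p ∈ U) (v : Fin n → ℝ) :
    ∃ l : ℝ, ∀ i, ∑ j, ∑ k, (Γ' p i j k - Γ p i j k) * v j * v k = l * v i := by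
  obtain ⟨γ, I, hI, h0, hγ, hγ0, hv⟩ := exists_isGeodesicOn hU hΓ hp v
  obtain ⟨τ, J, hJ, ⟨hτ, hτ', hbij⟩, hγ'⟩ := h.1 γ I hI hγ
  obtain ⟨t₀, ht₀, hτ0⟩ := hbij.surjOn h0
  have hτd : ∀ t ∈ J, HasDerivAt τ (deriv τ t) t := fun t ht =>
    ((hτ.differentiableOn (by simp)).differentiableAt (hJ.mem_nhds ht)).hasDerivAt
  have hτdd : HasDerivAt (deriv τ) (deriv (deriv τ) t₀) t₀ :=
    (((hτ.deriv_of_isOpen (m := ∞) hJ le_rfl).differentiableOn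
      (by simp)).differentiableAt (hJ.mem_nhds ht₀)).hasDerivAt
  have hγd : ∀ i, ∀ t ∈ I, HasDerivAt (fun u => γ u i) (deriv (fun u => γ u i) t) t :=
    fun i t ht =>
      (((hγ.2.1 i).differentiableOn (by simp)).differentiableAt (hI.mem_nhds ht)).hasDerivAt
  have hγdd : ∀ i, HasDerivAt (deriv fun u => γ u i) (deriv (deriv fun u => γ u i) 0) 0 :=
    fun i => ((((hγ.2.1 i).deriv_of_isOpen (m := ∞) hI le_rfl).differentiableOn
      (by simp)).differentiableAt (hI.mem_nhds h0)).hasDerivAt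
  have hd : ∀ i, ∀ t ∈ J, deriv (fun u => γ (τ u) i) t
      = deriv (fun u => γ u i) (τ t) * deriv τ t := fun i t ht =>
    ((hγd i (τ t) (hbij.mapsTo ht)).comp t (hτd t ht)).deriv
  have hdd : ∀ i, deriv (fun s => deriv (fun u => γ (τ u) i) s) t₀
      = deriv (deriv fun u => γ u i) 0 * deriv τ t₀ * deriv τ t₀ + v i * deriv (deriv τ) t₀ := by
    intro i
    have heq : (fun s => deriv (fun u => γ (τ u) i) s) =ᶠ[nhds t₀]
        fun s => deriv (fun u => γ u i) (τ s) * deriv τ s := by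
      filter_upwards [hJ.mem_nhds ht₀] with s hs using hd i s hs
    rw [heq.deriv_eq]
    have h1 : HasDerivAt (fun s => deriv (fun u => γ u i) (τ s))
        (deriv (deriv fun u => γ u i) 0 * deriv τ t₀) t₀ := by
      have := hγdd i
      rw [← hτ0] at this ⊢
      exact this.comp t₀ (hτd t₀ ht₀)
    have h2 := (h1.mul hτdd).deriv
    rw [hτ0, hv] at h2
    exact h2
  have ha : deriv τ t₀ ≠ 0 := hτ' t₀ ht₀
  refine ⟨-deriv (deriv τ) t₀ / (deriv τ t₀) ^ 2, fun i => ?_⟩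
  have e1 := hγ.2.2 0 h0 i
  have e2 := hγ'.2.2 t₀ ht₀ i
  simp only [hv, hγ0] at e1
  rw [hdd] at e2
  simp only [hd _ t₀ ht₀, hτ0, hv, hγ0] at e2
  have e3 : ∑ j, ∑ k, Γ' p i j k * (v j * deriv τ t₀) * (v k * deriv τ t₀)
      = (∑ j, ∑ k, Γ' p i j k * v j * v k) * (deriv τ t₀) ^ 2 := by
    simp only [Finset.sum_mul]
    exact Finset.sum_congr rfl fun j _ => Finset.sum_congr rfl fun k _ => by ring
  rw [e3] at e2
  simp only [sub_mul, Finset.sum_sub_distrib]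
  have e4 : deriv (deriv fun u => γ u i) 0 = -∑ j, ∑ k, Γ p i j k * v j * v k := by linarith
  rw [e4] at e2
  field_simp
  linarith

/-- A symmetric `D : Fin n → Fin n → Fin n → ℝ` with `D(v, v)` proportional to `v` for every `v`
is a symmetrised product of the identity with a covector. -/
lemma eq_delta_of_sum_eq_mul {n : ℕ} (D : Fin n → Fin n → Fin n → ℝ)
    (hsymm : ∀ i j k, D i j k = D i k j)
    (hD : ∀ v : Fin n → ℝ, ∃ l : ℝ, ∀ i, ∑ j, ∑ k, D i j k * v j * v k = l * v i) (i j k : Fin n) :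
    D i j k = (if i = j then D k k k / 2 else 0) + (if i = k then D j j j / 2 else 0) := by
  have key : ∀ a b : Fin n, a ≠ b → ∀ t : ℝ, ∃ l : ℝ, ∀ i,
      D i a a + 2 * t * D i a b + t ^ 2 * D i b b
        = l * ((if i = a then 1 else 0) + t * (if i = b then 1 else 0)) := by
    intro a b hab t
    obtain ⟨l, hl⟩ := hD fun i => (if i = a then 1 else 0) + t * (if i = b then 1 else 0)
    refine ⟨l, fun i => ?_⟩
    rw [← hl i]
    simp only [mul_add, add_mul, Finset.sum_add_distrib, mul_ite, ite_mul, mul_one, mul_zero,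
      zero_mul, Finset.sum_ite_eq', Finset.mem_univ, if_true]
    rw [hsymm i b a]
    ring
  have diag : ∀ a i : Fin n, i ≠ a → D i a a = 0 := by
    intro a i hia
    obtain ⟨l, hl⟩ := hD (Pi.single a 1)
    simpa [Pi.single_apply, hia] using hl i
  by_cases hjk : j = k
  · subst hjk
    by_cases hij : i = j
    · subst hij; simp
    · simp [hij, diag j i hij]
  · obtain ⟨l, hl⟩ := key j k hjk 1
    obtain ⟨m, hm⟩ := key j k hjk (-1)
    have hkj : k ≠ j := Ne.symm hjk
    have l1 := hl j; have l2 := hl k; have l3 := hl i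
    have m1 := hm j; have m2 := hm k
    simp only [hjk, hkj, if_true, if_false, diag j k hkj, diag k j hjk] at l1 l2 m1 m2
    by_cases hij : i = j
    · subst hij
      simp only [hjk, if_true, if_false]
      linarith
    · by_cases hik : i = k
      · subst hik
        simp only [hkj, if_true, if_false]
        linarith
      · simp only [hij, hik, if_false, diag j i hij, diag k i hik] at l3 ⊢
        linarith

/-- Projectively equivalent torsion-free connections are related by a projective change. -/
lemma ProjEquivOn.projChange {n : ℕ} {U : Set (Fin n → ℝ)} (hU : IsOpen U)
    {Γ Γ' : Christoffel n} (hΓ : SmoothChristoffelOn U Γ) (hsymm : ∀ p ∈ U, ∀ i j k, Γ p i j k = Γ p i k j)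
    (hsymm' : ∀ p ∈ U, ∀ i j k, Γ' p i j k = Γ' p i k j) (h : ProjEquivOn U Γ Γ') :
    ProjChange Γ Γ' (fun p k => (Γ' p k k k - Γ p k k k) / 2) U := by
  intro p hp i j k
  have := eq_delta_of_sum_eq_mul (fun i j k => Γ' p i j k - Γ p i j k)
    (fun i j k => by simp only [hsymm p hp i j k, hsymm' p hp i j k])
    (h.exists_sum_sub_eq_mul hU hΓ hp) i j k
  linarith

section PartialDerivatives

variable {n : ℕ} {U : Set (Fin n → ℝ)} {f f₁ f₂ : (Fin n → ℝ) → ℝ} {p : Fin n → ℝ}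

lemma pd_add (j : Fin n) (h₁ : DifferentiableAt ℝ f₁ p) (h₂ : DifferentiableAt ℝ f₂ p) :
    pd j (fun q => f₁ q + f₂ q) p = pd j f₁ p + pd j f₂ p := by
  simp [pd, fderiv_fun_add h₁ h₂]

lemma pd_sub (j : Fin n) (h₁ : DifferentiableAt ℝ f₁ p) (h₂ : DifferentiableAt ℝ f₂ p) :
    pd j (fun q => f₁ q - f₂ q) p = pd j f₁ p - pd j f₂ p := by
  simp [pd, fderiv_fun_sub h₁ h₂]

lemma pd_mul (j : Fin n) (h₁ : DifferentiableAt ℝ f₁ p) (h₂ : DifferentiableAt ℝ f₂ p) :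
    pd j (fun q => f₁ q * f₂ q) p = pd j f₁ p * f₂ p + f₁ p * pd j f₂ p := by
  simp [pd, fderiv_fun_mul h₁ h₂]
  ring

lemma pd_const_mul (j : Fin n) (c : ℝ) (h : DifferentiableAt ℝ f p) :
    pd j (fun q => c * f q) p = c * pd j f p := by
  simp [pd, fderiv_const_mul h]

lemma pd_sum (j : Fin n) {F : Fin n → (Fin n → ℝ) → ℝ} (h : ∀ a, DifferentiableAt ℝ (F a) p) :
    pd j (fun q => ∑ a, F a q) p = ∑ a, pd j (F a) p := by
  simp [pd, fderiv_fun_sum fun a _ => h a]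

lemma pd_congr (j : Fin n) (hU : IsOpen U) (hp : p ∈ U) (h : ∀ q ∈ U, f₁ q = f₂ q) :
    pd j f₁ p = pd j f₂ p := by
  have : f₁ =ᶠ[nhds p] f₂ := by filter_upwards [hU.mem_nhds hp] with q hq using h q hq
  simp [pd, this.fderiv_eq]

lemma differentiableAt_of_contDiffOn (hU : IsOpen U) (hf : ContDiffOn ℝ ∞ f U) (hp : p ∈ U) :
    DifferentiableAt ℝ f p :=
  (hf.differentiableOn (by simp)).differentiableAt (hU.mem_nhds hp)

lemma contDiffOn_pd (hU : IsOpen U) (hf : ContDiffOn ℝ ∞ f U) (j : Fin n) :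
    ContDiffOn ℝ ∞ (fun q => pd j f q) U :=
  (hf.fderiv_of_isOpen hU le_rfl).clm_apply contDiffOn_const

lemma pd_comm (hU : IsOpen U) (hf : ContDiffOn ℝ ∞ f U) (hp : p ∈ U) (j k : Fin n) :
    pd j (fun q => pd k f q) p = pd k (fun q => pd j f q) p := by
  have hs : IsSymmSndFDerivAt ℝ f p :=
    (hf.contDiffAt (hU.mem_nhds hp)).isSymmSndFDerivAt
      (by simpa using WithTop.coe_le_coe.2 (le_top (a := (2 : ℕ∞))))
  have hd : DifferentiableAt ℝ (fderiv ℝ f) p :=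
    ((hf.fderiv_of_isOpen (m := ∞) hU le_rfl).differentiableOn (by simp)).differentiableAt
      (hU.mem_nhds hp)
  have e : ∀ v w : Fin n → ℝ,
      fderiv ℝ (fun q => fderiv ℝ f q v) p w = fderiv ℝ (fderiv ℝ f) p w v := by
    intro v w
    rw [fderiv_clm_apply hd (differentiableAt_const v)]
    simp
  simp only [pd, e]
  exact hs _ _

end PartialDerivatives

section LeviCivita

variable {n : ℕ} {U : Set (Fin n → ℝ)} {g : (Fin n → ℝ) → Matrix (Fin n) (Fin n) ℝ}

lemma contDiffOn_det {A : (Fin n → ℝ) → Matrix (Fin n) (Fin n) ℝ}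
    (hA : ∀ i j, ContDiffOn ℝ ∞ (fun p => A p i j) U) :
    ContDiffOn ℝ ∞ (fun p => (A p).det) U := by
  simp only [Matrix.det_apply']
  exact ContDiffOn.sum fun σ _ => contDiffOn_const.mul (contDiffOn_prod fun i _ => hA _ _)

lemma MetricOn.contDiffOn_inv (hg : MetricOn U g) (i j : Fin n) :
    ContDiffOn ℝ ∞ (fun p => (g p)⁻¹ i j) U := by
  have h : ContDiffOn ℝ ∞ (fun p => (g p).det⁻¹ * (g p).adjugate i j) U := by
    refine ((contDiffOn_det hg.1).inv hg.2.2).mul ?_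
    simp only [Matrix.adjugate_apply]
    refine contDiffOn_det fun a b => ?_
    by_cases hab : a = j
    · simp only [hab, Matrix.updateRow_self]
      exact contDiffOn_const
    · simp only [Matrix.updateRow_ne hab]
      exact hg.1 a b
  refine h.congr fun p _ => ?_
  simp [Matrix.inv_def]

lemma MetricOn.smoothChristoffelOn (hU : IsOpen U) (hg : MetricOn U g) :
    SmoothChristoffelOn U (LeviCivita g) := by
  intro i j k
  refine contDiffOn_const.mul (ContDiffOn.sum fun s _ => (hg.contDiffOn_inv i s).mul ?_)
  exact ((contDiffOn_pd hU (hg.1 _ _) _).add (contDiffOn_pd hU (hg.1 _ _) _)).sub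
    (contDiffOn_pd hU (hg.1 _ _) _)

lemma MetricOn.pd_symm (hU : IsOpen U) (hg : MetricOn U g) {p : Fin n → ℝ} (hp : p ∈ U)
    (i j k : Fin n) : pd k (fun q => g q i j) p = pd k (fun q => g q j i) p :=
  pd_congr k hU hp fun q hq => hg.2.1 q hq i j

lemma MetricOn.leviCivita_symm (hU : IsOpen U) (hg : MetricOn U g) {p : Fin n → ℝ} (hp : p ∈ U)
    (i j k : Fin n) : LeviCivita g p i j k = LeviCivita g p i k j := by
  unfold LeviCivita
  congr 1
  refine Finset.sum_congr rfl fun s _ => ?_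
  rw [hg.pd_symm hU hp j k s]
  ring

lemma MetricOn.sum_mul_inv (hg : MetricOn U g) {p : Fin n → ℝ} (hp : p ∈ U) (i j : Fin n) :
    ∑ a, g p i a * (g p)⁻¹ a j = if i = j then 1 else 0 := by
  rw [← Matrix.mul_apply, Matrix.mul_nonsing_inv _ (isUnit_iff_ne_zero.2 (hg.2.2 p hp)),
    Matrix.one_apply]

/-- The Levi-Civita connection with lowered upper index is given by the Koszul formula. -/
lemma MetricOn.sum_mul_leviCivita (hg : MetricOn U g) {p : Fin n → ℝ} (hp : p ∈ U)
    (l j k : Fin n) : ∑ a, g p l a * LeviCivita g p a j k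
      = (pd j (fun q => g q l k) p + pd k (fun q => g q l j) p - pd l (fun q => g q j k) p) / 2 := by
  set X : Fin n → ℝ := fun s =>
    pd j (fun q => g q s k) p + pd k (fun q => g q s j) p - pd s (fun q => g q j k) p with hX
  have e : ∀ a, g p l a * LeviCivita g p a j k
      = ∑ s, (g p l a * (g p)⁻¹ a s) * (X s / 2) := by
    intro a
    simp only [LeviCivita, Finset.mul_sum]
    exact Finset.sum_congr rfl fun s _ => by simp only [hX]; ring
  simp only [e]
  rw [Finset.sum_comm]
  simp only [← Finset.sum_mul, hg.sum_mul_inv hp]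
  simp [hX]

/-- The Levi-Civita connection is compatible with the metric. -/
lemma MetricOn.pd_eq (hU : IsOpen U) (hg : MetricOn U g) {p : Fin n → ℝ} (hp : p ∈ U)
    (i j k : Fin n) : pd k (fun q => g q i j) p
      = ∑ a, (LeviCivita g p a k i * g p a j + LeviCivita g p a k j * g p a i) := by
  have e : ∀ i j, ∑ a, LeviCivita g p a k i * g p a j = ∑ a, g p j a * LeviCivita g p a k i :=
    fun i j => Finset.sum_congr rfl fun a _ => by rw [hg.2.1 p hp a j]; ring
  rw [Finset.sum_add_distrib, e, e, hg.sum_mul_leviCivita hp, hg.sum_mul_leviCivita hp,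
    hg.pd_symm hU hp j i k, hg.pd_symm hU hp k i j, hg.pd_symm hU hp k j i]
  ring

/-- The lowered curvature tensor is skew-symmetric in the first two indices. -/
lemma MetricOn.lowCurv_add_lowCurv (hU : IsOpen U) (hg : MetricOn U g) {p : Fin n → ℝ}
    (hp : p ∈ U) (h i j k : Fin n) : lowCurv g p h i j k + lowCurv g p i h j k = 0 := by
  have hs := hg.leviCivita_symm hU hp
  have dΓ : ∀ a b c, DifferentiableAt ℝ (fun q => LeviCivita g q a b c) p := fun a b c =>
    differentiableAt_of_contDiffOn hU (hg.smoothChristoffelOn hU a b c) hp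
  have dg : ∀ a b, DifferentiableAt ℝ (fun q => g q a b) p := fun a b =>
    differentiableAt_of_contDiffOn hU (hg.1 a b) hp
  have second : ∀ l k, pd l (fun q => pd k (fun q => g q h i) q) p
      = ∑ a, pd l (fun q => LeviCivita g q a k h) p * g p a i
        + ∑ a, ∑ b, LeviCivita g p a k h * LeviCivita g p b l a * g p b i
        + ∑ a, ∑ b, LeviCivita g p a k h * LeviCivita g p b l i * g p b a
        + ∑ a, pd l (fun q => LeviCivita g q a k i) p * g p a h
        + ∑ a, ∑ b, LeviCivita g p a k i * LeviCivita g p b l a * g p b h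
        + ∑ a, ∑ b, LeviCivita g p a k i * LeviCivita g p b l h * g p b a := by
    intro l k
    rw [pd_congr l hU hp fun q hq => hg.pd_eq hU hq h i k,
      pd_sum l fun a => ((dΓ a k h).fun_mul (dg a i)).fun_add ((dΓ a k i).fun_mul (dg a h))]
    simp only [← Finset.sum_add_distrib]
    refine Finset.sum_congr rfl fun a _ => ?_
    rw [pd_add l ((dΓ a k h).fun_mul (dg a i)) ((dΓ a k i).fun_mul (dg a h)),
      pd_mul l (dΓ a k h) (dg a i), pd_mul l (dΓ a k i) (dg a h),
      hg.pd_eq hU hp, hg.pd_eq hU hp]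
    simp only [Finset.sum_add_distrib, Finset.mul_sum, mul_add, ← mul_assoc]
    ring
  have mixed : ∀ l k, ∑ a, ∑ b, LeviCivita g p a k h * LeviCivita g p b l i * g p b a
      = ∑ a, ∑ b, LeviCivita g p a l i * LeviCivita g p b k h * g p b a := by
    intro l k
    rw [Finset.sum_comm]
    exact Finset.sum_congr rfl fun a _ => Finset.sum_congr rfl fun b _ => by
      rw [hg.2.1 p hp a b]; ring
  have low : ∀ h i, lowCurv g p h i j k
      = ∑ a, pd j (fun q => LeviCivita g q a k i) p * g p a h
        - ∑ a, pd k (fun q => LeviCivita g q a j i) p * g p a h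
        + ∑ a, ∑ b, LeviCivita g p a k i * LeviCivita g p b j a * g p b h
        - ∑ a, ∑ b, LeviCivita g p a j i * LeviCivita g p b k a * g p b h := by
    intro h i
    rw [Finset.sum_comm (f := fun a b => LeviCivita g p a k i * LeviCivita g p b j a * g p b h),
      Finset.sum_comm (f := fun a b => LeviCivita g p a j i * LeviCivita g p b k a * g p b h)]
    simp only [lowCurv, curv, ← Finset.sum_add_distrib, ← Finset.sum_sub_distrib]
    refine Finset.sum_congr rfl fun s _ => ?_
    rw [pd_congr j hU hp fun q hq => hg.leviCivita_symm hU hq s i k,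
      pd_congr k hU hp fun q hq => hg.leviCivita_symm hU hq s i j, hg.2.1 p hp h s]
    have e : ∀ j k, ∑ b, LeviCivita g p b k i * LeviCivita g p s j b * g p s h
        = g p s h * ∑ a, LeviCivita g p a i k * LeviCivita g p s a j := by
      intro j k
      rw [Finset.mul_sum]
      exact Finset.sum_congr rfl fun b _ => by rw [hs b i k, hs s b j]; ring
    rw [e, e]
    ring
  have := pd_comm hU (hg.1 h i) hp j k
  rw [second, second] at this
  rw [low, low]
  linarith [mixed j k, mixed k j]

end LeviCivita

section ProjectiveChange

variable {n : ℕ} {U : Set (Fin n → ℝ)}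

/-- The tensor `φ_{i;j} - φ_i φ_j`, where the semicolon is the covariant derivative with respect
to `Γ`. -/
def projTensor (Γ : Christoffel n) (φ : (Fin n → ℝ) → Fin n → ℝ) (p : Fin n → ℝ)
    (i j : Fin n) : ℝ :=
  pd j (fun q => φ q i) p - ∑ a, Γ p a i j * φ p a - φ p i * φ p j

lemma contDiffOn_projTensor (hU : IsOpen U) {Γ : Christoffel n} (hΓ : SmoothChristoffelOn U Γ)
    {φ : (Fin n → ℝ) → Fin n → ℝ} (hφ : ∀ i, ContDiffOn ℝ ∞ (fun p => φ p i) U) (i j : Fin n) :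
    ContDiffOn ℝ ∞ (fun p => projTensor Γ φ p i j) U :=
  ((contDiffOn_pd hU (hφ i) j).sub (ContDiffOn.sum fun a _ => (hΓ a i j).mul (hφ a))).sub
    ((hφ i).mul (hφ j))

/-- Transformation of the curvature tensor under a projective change. -/
lemma ProjChange.curv_eq (hU : IsOpen U) {Γ Γ' : Christoffel n} (hΓ : SmoothChristoffelOn U Γ)
    (hsymm : ∀ p ∈ U, ∀ i j k, Γ p i j k = Γ p i k j) {φ : (Fin n → ℝ) → Fin n → ℝ}
    (hφ : ∀ i, ContDiffOn ℝ ∞ (fun p => φ p i) U) (h : ProjChange Γ Γ' φ U)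
    {p : Fin n → ℝ} (hp : p ∈ U) (s i j k : Fin n) :
    curv Γ' p s i j k = curv Γ p s i j k
      + (if s = i then projTensor Γ φ p k j - projTensor Γ φ p j k else 0)
      + (if s = k then projTensor Γ φ p i j else 0)
      - (if s = j then projTensor Γ φ p i k else 0) := by
  have dΓ : ∀ a b c, DifferentiableAt ℝ (fun q => Γ q a b c) p := fun a b c =>
    differentiableAt_of_contDiffOn hU (hΓ a b c) hp
  have dφ : ∀ a, DifferentiableAt ℝ (fun q => φ q a) p := fun a =>
    differentiableAt_of_contDiffOn hU (hφ a) hp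
  have deriv_ite : ∀ (P : Prop) [Decidable P] (a l : Fin n),
      DifferentiableAt ℝ (fun q => if P then φ q a else 0) p ∧
      pd l (fun q => if P then φ q a else 0) p = if P then pd l (fun q => φ q a) p else 0 := by
    intro P _ a l
    by_cases hP : P
    · simp [hP, dφ]
    · simp [hP, pd]
  have first : ∀ l b, pd l (fun q => Γ' q s i b) p = pd l (fun q => Γ q s i b) p
      + (if s = i then pd l (fun q => φ q b) p else 0)
      + (if s = b then pd l (fun q => φ q i) p else 0) := by
    intro l b
    rw [pd_congr l hU hp fun q hq => h q hq s i b,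
      pd_add l ((dΓ s i b).fun_add (deriv_ite _ b l).1) (deriv_ite _ i l).1,
      pd_add l (dΓ s i b) (deriv_ite _ b l).1, (deriv_ite _ b l).2, (deriv_ite _ i l).2]
  have quad : ∀ j k, ∑ a, Γ' p a i k * Γ' p s a j = ∑ a, Γ p a i k * Γ p s a j
      + Γ p s i j * φ p k + Γ p s k j * φ p i + Γ p s i k * φ p j
      + (if s = j then ∑ a, Γ p a i k * φ p a else 0) + (if s = i then φ p k * φ p j else 0)
      + (if s = k then φ p i * φ p j else 0) + (if s = j then 2 * (φ p i * φ p k) else 0) := by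
    intro j k
    simp only [h p hp, add_mul, mul_add, Finset.sum_add_distrib, mul_ite, ite_mul, zero_mul,
      mul_zero, Finset.sum_ite_eq', Finset.sum_ite_eq, Finset.mem_univ, if_true]
    split_ifs <;> simp only [Finset.sum_add_distrib, Finset.sum_const_zero, Finset.sum_ite_eq',
      Finset.mem_univ, if_true] <;> ring
  unfold curv projTensor
  have e : ∑ a, Γ p a k j * φ p a = ∑ a, Γ p a j k * φ p a :=
    Finset.sum_congr rfl fun a _ => by rw [hsymm p hp a k j]
  rw [first, first, quad, quad, hsymm p hp s k j, e]
  split_ifs <;> ring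

lemma MetricOn.sum_inv_mul {g : (Fin n → ℝ) → Matrix (Fin n) (Fin n) ℝ} (hg : MetricOn U g)
    {p : Fin n → ℝ} (hp : p ∈ U) (i j : Fin n) :
    ∑ a, (g p)⁻¹ i a * g p a j = if i = j then 1 else 0 := by
  rw [← Matrix.mul_apply, Matrix.nonsing_inv_mul _ (isUnit_iff_ne_zero.2 (hg.2.2 p hp)),
    Matrix.one_apply]

/-- Lowering the upper index of a tensor with a metric is injective. -/
lemma MetricOn.eq_of_sum_mul_eq {g : (Fin n → ℝ) → Matrix (Fin n) (Fin n) ℝ} (hg : MetricOn U g)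
    {p : Fin n → ℝ} (hp : p ∈ U) {x y : Fin n → ℝ}
    (h : ∀ i, ∑ a, g p i a * x a = ∑ a, g p i a * y a) : x = y := by
  have hu : IsUnit (g p) := (Matrix.isUnit_iff_isUnit_det _).2 (isUnit_iff_ne_zero.2 (hg.2.2 p hp))
  exact Matrix.mulVec_injective_of_isUnit hu (funext h)

lemma MetricOn.curv_eq_of_lowCurv_eq {g : (Fin n → ℝ) → Matrix (Fin n) (Fin n) ℝ}
    (hg : MetricOn U g) {p : Fin n → ℝ} (hp : p ∈ U) {c : ℝ}
    (hc : ∀ h i j k, lowCurv g p h i j k = c * (g p h k * g p i j - g p h j * g p i k))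
    (s i j k : Fin n) : curv (LeviCivita g) p s i j k
      = (if s = k then c * g p i j else 0) - (if s = j then c * g p i k else 0) := by
  refine congrFun (hg.eq_of_sum_mul_eq hp (x := fun s => curv (LeviCivita g) p s i j k)
    (y := fun s => (if s = k then c * g p i j else 0) - (if s = j then c * g p i k else 0))
    fun h => ?_) s
  have := hc h i j k
  rw [lowCurv] at this
  rw [this]
  simp only [mul_sub, Finset.sum_sub_distrib, mul_ite, mul_zero, Finset.sum_ite_eq',
    Finset.mem_univ, if_true]
  ring

/-- If the tensor `g_{hi} (B_{kj} - B_{jk}) + g_{hk} B_{ij} - g_{hj} B_{ik}` is skew-symmetric in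
`h, i`, then `B` is proportional to `g`. -/
lemma MetricOn.eq_trace_mul {g : (Fin n → ℝ) → Matrix (Fin n) (Fin n) ℝ} (hg : MetricOn U g)
    (hn : n ≠ 0) {p : Fin n → ℝ} (hp : p ∈ U) {B : Fin n → Fin n → ℝ}
    (hB : ∀ h i j k, g p h i * (B k j - B j k) + g p h k * B i j - g p h j * B i k
      + (g p i h * (B k j - B j k) + g p i k * B h j - g p i j * B h k) = 0) (i j : Fin n) :
    B i j = (∑ a, ∑ b, (g p)⁻¹ a b * B a b) / n * g p i j := by
  have hn' : (n : ℝ) ≠ 0 := Nat.cast_ne_zero.2 hn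
  have gs := hg.2.1 p hp
  have contr : ∀ (x : Fin n → ℝ) (k : Fin n),
      ∑ h, ∑ i, (g p)⁻¹ h i * (g p i k * x h) = x k := by
    intro x k
    simp only [← mul_assoc, ← Finset.sum_mul, hg.sum_inv_mul hp]
    simp
  have contr' : ∀ (x : Fin n → ℝ) (k : Fin n),
      ∑ h, ∑ i, (g p)⁻¹ h i * (g p h k * x i) = x k := by
    intro x k
    rw [Finset.sum_comm, ← contr x k]
    refine Finset.sum_congr rfl fun a _ => Finset.sum_congr rfl fun b _ => ?_
    have : (g p)⁻¹ b a = (g p)⁻¹ a b := by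
      have ht : (g p).transpose = g p := by ext a b; exact gs b a
      conv_lhs => rw [← ht, ← Matrix.transpose_nonsing_inv, Matrix.transpose_apply]
    rw [this]
  have contr_one : ∀ x : ℝ, ∑ h, ∑ i, (g p)⁻¹ h i * (g p h i * x) = n * x := by
    intro x
    have : ∀ h i, (g p)⁻¹ h i * (g p h i * x) = (g p)⁻¹ h i * g p i h * x := by
      intro h i; rw [gs h i]; ring
    simp only [this, ← Finset.sum_mul, hg.sum_inv_mul hp]
    simp
  have symm : ∀ j k, B k j = B j k := by
    intro j k
    have e : ∑ h, ∑ i, ((g p)⁻¹ h i * (g p h i * (2 * (B k j - B j k)))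
        + (g p)⁻¹ h i * (g p h k * B i j) + (g p)⁻¹ h i * (g p i k * B h j)
        - (g p)⁻¹ h i * (g p h j * B i k) - (g p)⁻¹ h i * (g p i j * B h k)) = 0 :=
      Finset.sum_eq_zero fun h _ => Finset.sum_eq_zero fun i _ => by
        have := hB h i j k
        rw [gs i h] at this
        linear_combination (g p)⁻¹ h i * this
    simp only [Finset.sum_add_distrib, Finset.sum_sub_distrib] at e
    rw [contr_one, contr' (fun i => B i j), contr (fun h => B h j), contr' (fun i => B i k),
      contr (fun h => B h k)] at e
    have e' : (2 * n + 2 : ℝ) * (B k j - B j k) = 0 := by linear_combination e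
    rcases mul_eq_zero.1 e' with h0 | h0
    · exact absurd h0 (by positivity)
    · linarith
  have e : ∑ h, ∑ k, ((g p)⁻¹ h k * (g p h k * B i j) + (g p)⁻¹ h k * (g p k i * B h j)
      - (g p)⁻¹ h k * (g p h j * B i k) - (g p)⁻¹ h k * B h k * g p i j) = 0 :=
    Finset.sum_eq_zero fun h _ => Finset.sum_eq_zero fun k _ => by
      have := hB h i j k
      rw [symm j k, gs i k] at this
      linear_combination (g p)⁻¹ h k * this
  simp only [Finset.sum_add_distrib, Finset.sum_sub_distrib] at e
  rw [contr_one, contr (fun h => B h j), contr' (fun k => B i k)] at e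
  simp only [← Finset.sum_mul] at e
  field_simp
  linarith

/-- A conformal factor `f` such that `c g_{ij} + φ_{i;j} - φ_i φ_j = f ḡ_{ij}` has vanishing
differential, provided that `g` has constant sectional curvature `c` and that the Levi-Civita
connections of `g` and `ḡ` differ by the projective change associated with `φ`. -/
lemma ProjChange.pd_factor_eq_zero (hn : 2 ≤ n) (hU : IsOpen U)
    {g g' : (Fin n → ℝ) → Matrix (Fin n) (Fin n) ℝ} (hg : MetricOn U g) (hg' : MetricOn U g')
    {φ : (Fin n → ℝ) → Fin n → ℝ} (hφ : ∀ i, ContDiffOn ℝ ∞ (fun p => φ p i) U)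
    (h : ProjChange (LeviCivita g) (LeviCivita g') φ U) {c : ℝ}
    (hc : ∀ p ∈ U, ∀ h i j k,
      lowCurv g p h i j k = c * (g p h k * g p i j - g p h j * g p i k))
    {f : (Fin n → ℝ) → ℝ} (hf : ContDiffOn ℝ ∞ f U)
    (hfg : ∀ p ∈ U, ∀ i j, c * g p i j + projTensor (LeviCivita g) φ p i j = f p * g' p i j)
    {p : Fin n → ℝ} (hp : p ∈ U) (k : Fin n) : pd k f p = 0 := by
  have hΓ := hg.smoothChristoffelOn hU
  have dΓ : ∀ a b c, DifferentiableAt ℝ (fun q => LeviCivita g q a b c) p := fun a b c =>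
    differentiableAt_of_contDiffOn hU (hΓ a b c) hp
  have dφ : ∀ a, DifferentiableAt ℝ (fun q => φ q a) p := fun a =>
    differentiableAt_of_contDiffOn hU (hφ a) hp
  have ddφ : ∀ a j, DifferentiableAt ℝ (fun q => pd j (fun q => φ q a) q) p := fun a j =>
    differentiableAt_of_contDiffOn hU (contDiffOn_pd hU (hφ a) j) hp
  have dg : ∀ a b, DifferentiableAt ℝ (fun q => g q a b) p := fun a b =>
    differentiableAt_of_contDiffOn hU (hg.1 a b) hp
  have dg' : ∀ a b, DifferentiableAt ℝ (fun q => g' q a b) p := fun a b =>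
    differentiableAt_of_contDiffOn hU (hg'.1 a b) hp
  have df : DifferentiableAt ℝ f p := differentiableAt_of_contDiffOn hU hf hp
  have hs := hg.leviCivita_symm hU hp
  have dS : ∀ i j, DifferentiableAt ℝ (fun q => ∑ a, LeviCivita g q a i j * φ q a) p :=
    fun i j => DifferentiableAt.fun_sum fun a _ => (dΓ a i j).fun_mul (dφ a)
  have covφ : ∀ a k, pd k (fun q => φ q a) p = f p * g' p a k - c * g p a k
      + ∑ b, LeviCivita g p b a k * φ p b + φ p a * φ p k := by
    intro a k
    have := hfg p hp a k
    rw [projTensor] at this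
    linarith
  -- the derivative of the defining equation of `f`
  have deriv_eq : ∀ i j k, pd k f p * g' p i j + f p * pd k (fun q => g' q i j) p
      = c * pd k (fun q => g q i j) p + pd k (fun q => pd j (fun q => φ q i) q) p
        - ∑ a, pd k (fun q => LeviCivita g q a i j) p * φ p a
        - f p * ∑ a, LeviCivita g p a i j * g' p a k + c * ∑ a, LeviCivita g p a i j * g p a k
        - ∑ a, ∑ b, LeviCivita g p a i j * LeviCivita g p b a k * φ p b
        - (∑ a, LeviCivita g p a i j * φ p a) * φ p k
        - pd k (fun q => φ q i) p * φ p j - φ p i * pd k (fun q => φ q j) p := by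
    intro i j k
    have e := pd_congr k hU hp fun q hq => hfg q hq i j
    rw [pd_mul k df (dg' i j)] at e
    unfold projTensor at e
    rw [pd_add k ((dg i j).const_mul c)
        (((ddφ i j).fun_sub (dS i j)).fun_sub ((dφ i).fun_mul (dφ j))),
      pd_sub k ((ddφ i j).fun_sub (dS i j)) ((dφ i).fun_mul (dφ j)), pd_sub k (ddφ i j) (dS i j),
      pd_const_mul k c (dg i j), pd_mul k (dφ i) (dφ j),
      pd_sum k fun a => (dΓ a i j).fun_mul (dφ a)] at e
    have e' : ∑ a, pd k (fun q => LeviCivita g q a i j * φ q a) p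
        = ∑ a, pd k (fun q => LeviCivita g q a i j) p * φ p a
        + f p * ∑ a, LeviCivita g p a i j * g' p a k - c * ∑ a, LeviCivita g p a i j * g p a k
        + ∑ a, ∑ b, LeviCivita g p a i j * LeviCivita g p b a k * φ p b
        + (∑ a, LeviCivita g p a i j * φ p a) * φ p k := by
      simp only [Finset.mul_sum, Finset.sum_mul, ← Finset.sum_add_distrib,
        ← Finset.sum_sub_distrib]
      refine Finset.sum_congr rfl fun a _ => ?_
      rw [pd_mul k (dΓ a i j) (dφ a), covφ]
      simp only [mul_assoc, ← Finset.mul_sum]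
      ring
    rw [e'] at e
    linarith
  have curvφ : ∀ i j k, ∑ a, pd j (fun q => LeviCivita g q a i k) p * φ p a
      - ∑ a, pd k (fun q => LeviCivita g q a i j) p * φ p a
      + ∑ a, ∑ b, LeviCivita g p a i k * LeviCivita g p b a j * φ p b
      - ∑ a, ∑ b, LeviCivita g p a i j * LeviCivita g p b a k * φ p b
      = c * (g p i j * φ p k - g p i k * φ p j) := by
    intro i j k
    have e : ∑ a, curv (LeviCivita g) p a i j k * φ p a
        = c * (g p i j * φ p k - g p i k * φ p j) := by
      simp only [hg.curv_eq_of_lowCurv_eq hp (hc p hp), sub_mul, Finset.sum_sub_distrib, ite_mul,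
        zero_mul, Finset.sum_ite_eq', Finset.mem_univ, if_true]
      ring
    rw [← e, Finset.sum_comm (f := fun a b => LeviCivita g p a i k * LeviCivita g p b a j * φ p b),
      Finset.sum_comm (f := fun a b => LeviCivita g p a i j * LeviCivita g p b a k * φ p b)]
    simp only [curv, add_mul, sub_mul, Finset.sum_add_distrib, Finset.sum_sub_distrib,
      Finset.sum_mul]
  have compat : ∀ i j k, pd k (fun q => g q i j) p = ∑ a, LeviCivita g p a i k * g p a j
      + ∑ a, LeviCivita g p a j k * g p a i := by
    intro i j k
    simp only [hg.pd_eq hU hp, Finset.sum_add_distrib, hs _ k _]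
  have compat' : ∀ i j k, pd k (fun q => g' q i j) p = ∑ a, LeviCivita g p a i k * g' p a j
      + ∑ a, LeviCivita g p a j k * g' p a i + 2 * φ p k * g' p i j + φ p i * g' p k j
      + φ p j * g' p k i := by
    intro i j k
    rw [hg'.pd_eq hU hp]
    simp only [h p hp, add_mul, ite_mul, zero_mul, Finset.sum_add_distrib, Finset.sum_ite_eq',
      Finset.mem_univ, if_true, hs _ k _]
    rw [hg'.2.1 p hp j i]
    ring
  have cross : ∀ i j k, pd k f p * g' p i j = pd j f p * g' p i k := by
    intro i j k
    have e₁ := deriv_eq i j k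
    have e₂ := deriv_eq i k j
    have e₃ := curvφ i j k
    have e₄ : ∀ x : Fin n → ℝ,
        ∑ a, LeviCivita g p a k j * x a = ∑ a, LeviCivita g p a j k * x a :=
      fun x => Finset.sum_congr rfl fun a _ => by rw [hs a k j]
    rw [compat, compat', covφ, covφ] at e₁ e₂
    rw [e₄ fun a => g p a i, e₄ fun a => g' p a i, e₄ fun a => φ p a] at e₂
    have e₅ := pd_comm hU (hφ i) hp j k
    have g1 := hg'.2.1 p hp k j
    have g2 := hg'.2.1 p hp k i
    have g3 := hg'.2.1 p hp j i
    have g4 := hg.2.1 p hp k j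
    rw [g1, g2] at e₁
    rw [g3, g1, g4] at e₂
    linear_combination e₁ - e₂ + e₃ - e₅
  have : Nontrivial (Fin n) := Fin.nontrivial_iff_two_le.2 hn
  obtain ⟨j, hj⟩ := exists_ne k
  have e := hg'.eq_of_sum_mul_eq hp (x := fun a => if a = j then pd k f p else 0)
    (y := fun a => if a = k then pd j f p else 0) fun i => by
      simpa [mul_comm] using cross i j k
  simpa [hj] using congrFun e j

end ProjectiveChange

/-- **Beltrami theorem.** If `g` and `ḡ` are projectively equivalent
Riemannian metrics on a connected domain of dimension `n ≥ 2` and `g` has constant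
sectional curvature, then `ḡ` also has constant sectional curvature. -/
theorem statement_17 {n : ℕ} (hn : 2 ≤ n) (U : Set (Fin n → ℝ)) (hU : IsOpen U)
    (hconn : IsConnected U)
    (g gbar : (Fin n → ℝ) → Matrix (Fin n) (Fin n) ℝ)
    (hg : RiemannianOn U g) (hgbar : RiemannianOn U gbar)
    (hproj : ProjEquivOn U (LeviCivita g) (LeviCivita gbar))
    (hconst : HasConstSectionalCurv U g) :
    HasConstSectionalCurv U gbar := by
  obtain ⟨c, hc⟩ := hconst
  have hn0 : n ≠ 0 := by omega
  have hΓ := hg.1.smoothChristoffelOn hU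
  have hΓ' := hgbar.1.smoothChristoffelOn hU
  set φ : (Fin n → ℝ) → Fin n → ℝ :=
    fun p k => (LeviCivita gbar p k k k - LeviCivita g p k k k) / 2 with hφdef
  have hφ : ∀ i, ContDiffOn ℝ ∞ (fun p => φ p i) U := fun i =>
    ((hΓ' i i i).sub (hΓ i i i)).div_const 2
  have hchange : ProjChange (LeviCivita g) (LeviCivita gbar) φ U :=
    hproj.projChange hU hΓ (fun p hp => hg.1.leviCivita_symm hU hp)
      fun p hp => hgbar.1.leviCivita_symm hU hp
  set B : (Fin n → ℝ) → Fin n → Fin n → ℝ :=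
    fun p i j => c * g p i j + projTensor (LeviCivita g) φ p i j with hBdef
  have hlow : ∀ p ∈ U, ∀ h i j k, lowCurv gbar p h i j k
      = gbar p h i * (B p k j - B p j k) + gbar p h k * B p i j - gbar p h j * B p i k := by
    intro p hp h i j k
    simp only [lowCurv, hchange.curv_eq hU hΓ (fun p hp => hg.1.leviCivita_symm hU hp) hφ hp,
      hg.1.curv_eq_of_lowCurv_eq hp (hc p hp), mul_add, mul_sub, Finset.sum_add_distrib,
      Finset.sum_sub_distrib, mul_ite, mul_zero, Finset.sum_ite_eq', Finset.mem_univ, if_true,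
      hBdef]
    rw [hg.1.2.1 p hp k j]
    ring
  set f : (Fin n → ℝ) → ℝ := fun p => (∑ a, ∑ b, (gbar p)⁻¹ a b * B p a b) / n with hfdef
  have hBf : ∀ p ∈ U, ∀ i j, B p i j = f p * gbar p i j := fun p hp =>
    hgbar.1.eq_trace_mul hn0 hp fun h i j k => by
      rw [← hlow p hp, ← hlow p hp, hgbar.1.lowCurv_add_lowCurv hU hp]
  have hf : ContDiffOn ℝ ∞ f U := by
    refine ContDiffOn.div_const (ContDiffOn.sum fun a _ => ContDiffOn.sum fun b _ => ?_) _
    exact (hgbar.1.contDiffOn_inv a b).mul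
      ((contDiffOn_const.mul (hg.1.1 a b)).add (contDiffOn_projTensor hU hΓ hφ a b))
  obtain ⟨C, hC⟩ := hU.exists_is_const_of_fderiv_eq_zero hconn.isPreconnected
    (hf.differentiableOn (by simp)) fun p hp => by
      refine ContinuousLinearMap.coe_injective (LinearMap.pi_ext' fun k => ?_)
      ext
      exact hchange.pd_factor_eq_zero hn hU hg.1 hgbar.1 hφ hc hf hBf hp k
  refine ⟨C, fun p hp h i j k => ?_⟩
  rw [hlow p hp]
  simp only [hBf p hp, hC p hp]
  rw [hgbar.1.2.1 p hp k j]
  ring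

end ProjGeo
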